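/- arXiv:2012.05683 — 3 statements merged into one kernel-verified Lean document; each statement's English description precedes it below -/
import Mathlib

section
/- Let M be a matroid of rank d on a finite ground set E with closure operator cl, let Y₁, Y₂ be cocircuits of M forming a modular pair, and let I be a maximal independent subset of E ∖ (Y₁ ∪ Y₂). Then |I| = d − 2, and for every e ∈ Y₁ ∩ Y₂ the set E ∖ cl(I ∪ {e}) is a cocircuit of M. -/
/-!
Statement 1: If `Y₁, Y₂` are a modular pair of cocircuits of a finite matroid `M`
of rank `d`, and `I` is a maximal independent subset of `E \ (Y₁ ∪ Y₂)`, then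
`|I| = d - 2` and for every `e ∈ Y₁ ∩ Y₂` the set `E \ cl(I ∪ {e})` is a
cocircuit of `M`.
-/

open Set

namespace PaperStmt1

variable {α : Type*}

/-- The rank of a set `X` in a matroid `M`. -/
noncomputable def rk (M : Matroid α) (X : Set α) : ℕ :=
  sSup {n | ∃ I, M.Indep I ∧ I ⊆ X ∧ I.ncard = n}

/-- A circuit: a minimal dependent set. -/
def Circuit (M : Matroid α) (C : Set α) : Prop :=
  M.Dep C ∧ ∀ D, M.Dep D → D ⊆ C → D = C

/-- A cocircuit: a circuit of the dual matroid. -/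
def Cocircuit (M : Matroid α) (C : Set α) : Prop :=
  Circuit M✶ C

/-- A set which is a union of (sets of) cocircuits of `M`. -/
def UnionOfCocircuits (M : Matroid α) (Z : Set α) : Prop :=
  ∃ S : Set (Set α), (∀ C ∈ S, Cocircuit M C) ∧ Z = ⋃₀ S

/-- Two cocircuits form a modular pair if they are distinct and their union has
height 2 in the lattice of unions of cocircuits. -/
def ModularPairOfCocircuits (M : Matroid α) (Y₁ Y₂ : Set α) : Prop :=
  Y₁ ≠ Y₂ ∧ ¬ ∃ Z₁ Z₂ : Set α, UnionOfCocircuits M Z₁ ∧ UnionOfCocircuits M Z₂ ∧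
    ∅ ⊂ Z₁ ∧ Z₁ ⊂ Z₂ ∧ Z₂ ⊂ Y₁ ∪ Y₂

theorem cocircuit_iff_isCocircuit {M : Matroid α} {C : Set α} :
    Cocircuit M C ↔ M.IsCocircuit C := by
  rw [Matroid.isCocircuit_def, Matroid.isCircuit_def, minimal_iff]
  exact and_congr_right fun _ ↦
    ⟨fun h D hD hDC ↦ (h D hD hDC).symm, fun h D hD hDC ↦ (h hD hDC).symm⟩

theorem rk_ground_eq_ncard_of_isBase {M : Matroid α} [M.Finite] {B : Set α}
    (hB : M.IsBase B) : rk M M.E = B.ncard := by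
  refine IsGreatest.csSup_eq ⟨⟨B, hB.indep, hB.subset_ground, rfl⟩, ?_⟩
  rintro _ ⟨J, hJ, -, rfl⟩
  obtain ⟨B', hB', hJB'⟩ := hJ.exists_isBase_superset
  exact (ncard_le_ncard hJB' hB'.finite).trans_eq (hB'.ncard_eq_ncard_of_isBase hB)

theorem disjoint_closure_of_isCocircuit {M : Matroid α} {K X : Set α}
    (hK : M.IsCocircuit K) (hX : X ⊆ M.E \ K) : Disjoint (M.closure X) K := by
  rw [disjoint_left]
  intro e heX heK
  rw [Matroid.isCocircuit_iff_minimal_compl_nonspanning] at hK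
  have he : e ∈ M.closure (M.E \ K) := M.closure_subset_closure hX heX
  have hsub : M.E \ (K \ {e}) ⊆ insert e (M.E \ K) := by
    rintro x ⟨hxE, hx⟩
    by_cases hxe : x = e
    · exact Or.inl hxe
    · exact Or.inr ⟨hxE, fun hxK ↦ hx ⟨hxK, hxe⟩⟩
  have hnot : ¬ M.Spanning (M.E \ (K \ {e})) := by
    intro hs
    refine hK.prop ?_
    have hs' := hs.superset hsub
      (insert_subset (M.mem_ground_of_mem_closure heX) sdiff_subset)
    rw [Matroid.spanning_iff_closure_eq] at hs' ⊢
    rwa [Matroid.closure_insert_eq_of_mem_closure he] at hs'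
  exact (hK.le_of_le hnot sdiff_subset heK).2 rfl

theorem closure_eq_compl_union_of_maximal {M : Matroid α} {Y₁ Y₂ I : Set α}
    (hY₁ : M.IsCocircuit Y₁) (hY₂ : M.IsCocircuit Y₂)
    (hIsub : I ⊆ M.E \ (Y₁ ∪ Y₂)) (hI : M.Indep I)
    (hImax : ∀ J, M.Indep J → J ⊆ M.E \ (Y₁ ∪ Y₂) → I ⊆ J → J = I) :
    M.closure I = M.E \ (Y₁ ∪ Y₂) := by
  refine subset_antisymm ?_ ?_
  · refine fun x hx ↦ ⟨M.mem_ground_of_mem_closure hx, ?_⟩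
    rintro (h | h)
    · exact (disjoint_closure_of_isCocircuit hY₁
        (hIsub.trans (sdiff_subset_sdiff_right subset_union_left))).notMem_of_mem_left hx h
    · exact (disjoint_closure_of_isCocircuit hY₂
        (hIsub.trans (sdiff_subset_sdiff_right subset_union_right))).notMem_of_mem_left hx h
  · intro x hx
    by_contra hxI
    have hins : M.Indep (insert x I) := (hI.notMem_closure_iff_of_notMem
      (fun h ↦ hxI (M.mem_closure_of_mem h hI.subset_ground)) hx.1).1 hxI
    have heq := hImax _ hins (insert_subset hx hIsub) (subset_insert x I)
    exact hxI (M.mem_closure_of_mem (heq ▸ mem_insert x I) hI.subset_ground)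

theorem ncard_isBase_sdiff_eq_two {M : Matroid α} [M.Finite] {Y₁ Y₂ I B : Set α}
    (hY₁ : M.IsCocircuit Y₁) (hY₂ : M.IsCocircuit Y₂)
    (hmod : ModularPairOfCocircuits M Y₁ Y₂)
    (hcl : M.closure I = M.E \ (Y₁ ∪ Y₂)) (hB : M.IsBase B) (hIB : I ⊆ B) :
    (B \ I).ncard = 2 := by
  have hfin : (B \ I).Finite := hB.finite.sdiff
  have hY : M.E \ M.closure I = Y₁ ∪ Y₂ := by
    rw [hcl, sdiff_sdiff_cancel_left (union_subset hY₁.subset_ground hY₂.subset_ground)]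
  have hcoc : ∀ b ∈ B, M.IsCocircuit (M.E \ M.closure (B \ {b})) :=
    fun b hb ↦ hB.compl_closure_sdiff_singleton_isCocircuit hb
  have hmem : ∀ b ∈ B, b ∈ M.E \ M.closure (B \ {b}) := fun b hb ↦
    ⟨hB.subset_ground hb, hB.indep.notMem_closure_sdiff_of_mem hb⟩
  have hnot : ∀ b ∈ B, ∀ c, b ≠ c → b ∉ M.E \ M.closure (B \ {c}) := fun b hb c hbc h ↦
    h.2 (M.mem_closure_of_mem ⟨hb, hbc⟩ (sdiff_subset.trans hB.subset_ground))
  have hsub : ∀ b ∈ B \ I, M.E \ M.closure (B \ {b}) ⊆ Y₁ ∪ Y₂ := fun b hb ↦ by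
    rw [← hY]
    exact sdiff_subset_sdiff_right (M.closure_subset_closure
      (subset_sdiff_singleton hIB hb.2))
  refine le_antisymm ?_ ?_
  · by_contra! hlt
    obtain ⟨a, ha, b, hb, c, hc, hab, hac, hbc⟩ := (two_lt_ncard hfin).1 hlt
    refine hmod.2 ⟨M.E \ M.closure (B \ {a}),
      (M.E \ M.closure (B \ {a})) ∪ (M.E \ M.closure (B \ {b})),
      ⟨{M.E \ M.closure (B \ {a})}, ?_, by simp⟩,
      ⟨{M.E \ M.closure (B \ {a}), M.E \ M.closure (B \ {b})}, ?_, by simp⟩, ?_, ?_, ?_⟩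
    · rintro _ rfl
      exact cocircuit_iff_isCocircuit.2 (hcoc a ha.1)
    · rintro _ (rfl | rfl)
      · exact cocircuit_iff_isCocircuit.2 (hcoc a ha.1)
      · exact cocircuit_iff_isCocircuit.2 (hcoc b hb.1)
    · exact empty_ssubset.2 ⟨a, hmem a ha.1⟩
    · exact ⟨subset_union_left, fun h ↦
        hnot b hb.1 a hab.symm (h (Or.inr (hmem b hb.1)))⟩
    · refine ⟨union_subset (hsub a ha) (hsub b hb), fun h ↦ ?_⟩
      exact (h (hsub c hc (hmem c hc.1))).elim (hnot c hc.1 a hac.symm) (hnot c hc.1 b hbc.symm)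
  · by_contra! hlt
    rcases (ncard_le_one_iff_eq hfin).1 (Nat.lt_succ_iff.1 hlt) with h0 | ⟨b, hb⟩
    · have hBI : B = I := (sdiff_eq_empty.1 h0).antisymm hIB
      obtain ⟨x, hx⟩ := hY₁.nonempty
      have : x ∈ M.E \ M.closure I := hY ▸ Or.inl hx
      rw [← hBI, hB.closure_eq, Set.sdiff_self] at this
      exact this
    · have hbB : b ∈ B \ I := hb ▸ mem_singleton b
      have hBI : B \ {b} = I := by rw [← hb, sdiff_sdiff_cancel_left hIB]
      have hK := hcoc b hbB.1
      rw [hBI, hY] at hK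
      exact hmod.1 ((hY₁.eq_of_subset_isCircuit hK subset_union_left).trans
        (hY₂.eq_of_subset_isCircuit hK subset_union_right).symm)

theorem modular_pair_maximal_indep (M : Matroid α) [M.Finite] (d : ℕ)
    (hd : rk M M.E = d)
    (Y₁ Y₂ : Set α) (hY₁ : Cocircuit M Y₁) (hY₂ : Cocircuit M Y₂)
    (hmod : ModularPairOfCocircuits M Y₁ Y₂)
    (I : Set α) (hIsub : I ⊆ M.E \ (Y₁ ∪ Y₂)) (hIindep : M.Indep I)
    (hImax : ∀ J, M.Indep J → J ⊆ M.E \ (Y₁ ∪ Y₂) → I ⊆ J → J = I) :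
    (I.ncard : ℤ) = (d : ℤ) - 2 ∧
      ∀ e ∈ Y₁ ∩ Y₂, Cocircuit M (M.E \ M.closure (I ∪ {e})) := by
  rw [cocircuit_iff_isCocircuit] at hY₁ hY₂
  have hcl := closure_eq_compl_union_of_maximal hY₁ hY₂ hIsub hIindep hImax
  refine ⟨?_, fun e he ↦ ?_⟩
  · obtain ⟨B, hB, hIB⟩ := hIindep.exists_isBase_superset
    have h2 := ncard_isBase_sdiff_eq_two hY₁ hY₂ hmod hcl hB hIB
    have hadd := ncard_sdiff_add_ncard_of_subset hIB hB.finite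
    rw [rk_ground_eq_ncard_of_isBase hB] at hd
    omega
  · have heE : e ∈ M.E := hY₁.subset_ground he.1
    have heI : e ∉ I := fun h ↦ (hIsub h).2 (Or.inl he.1)
    have hecl : e ∉ M.closure I := fun h ↦ (hcl ▸ h : e ∈ M.E \ (Y₁ ∪ Y₂)).2 (Or.inl he.1)
    have hins : M.Indep (insert e I) :=
      (hIindep.notMem_closure_iff_of_notMem heI heE).1 hecl
    obtain ⟨B, hB, hIB⟩ := hins.exists_isBase_superset
    have hIB' : I ⊆ B := (subset_insert e I).trans hIB
    obtain ⟨x, y, hxy, hBI⟩ := ncard_eq_two.1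
      (ncard_isBase_sdiff_eq_two hY₁ hY₂ hmod hcl hB hIB')
    have heB : e ∈ B \ I := ⟨hIB (mem_insert e I), heI⟩
    obtain ⟨f, hfe, hBI⟩ : ∃ f, f ≠ e ∧ B \ I = {e, f} := by
      rw [hBI] at heB
      rcases heB with rfl | rfl
      · exact ⟨y, hxy.symm, hBI⟩
      · exact ⟨x, hxy, hBI.trans (pair_comm _ _)⟩
    have hfB : f ∈ B \ I := hBI ▸ Or.inr rfl
    have hB' : B \ {f} = I ∪ {e} := by
      ext z
      have hz := Set.ext_iff.1 hBI z
      simp only [mem_sdiff, mem_insert_iff, mem_singleton_iff, mem_union] at hz hfB ⊢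
      have := @hIB' z
      grind
    rw [cocircuit_iff_isCocircuit, ← hB']
    exact hB.compl_closure_sdiff_singleton_isCocircuit hfB.1

end PaperStmt1
end

section
/- Let F be a skew hyperfield and let a, b ∈ F. For any x, y ∈ F with x ∈ 1 ⊞ a and y ∈ (−1) ⊞ b, the following three intersections are nonempty: (x ⊞ y) ∩ (a ⊞ b), (x ⊞ y) ∩ ((x·b) ⊞ (−(a·y))), and (a ⊞ b) ∩ ((x·b) ⊞ (−(a·y))). -/
open Set

namespace PaperSHF

/-- A skew hyperfield: `F ∖ {0}` is a group under `mul`, `0` is multiplicatively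
absorbing, and `add` is a commutative associative hyperaddition with neutral
element `0`, hyperinverses, reversibility, and two-sided distributivity. -/
structure SkewHyperfield (F : Type*) where
  zero : F
  one : F
  mul : F → F → F
  inv : F → F
  neg : F → F
  add : F → F → Set F
  zero_ne_one : zero ≠ one
  mul_assoc : ∀ a b c, mul (mul a b) c = mul a (mul b c)
  one_mul : ∀ a, mul one a = a
  mul_one : ∀ a, mul a one = a
  mul_ne_zero : ∀ a b, a ≠ zero → b ≠ zero → mul a b ≠ zero
  inv_ne_zero : ∀ a, a ≠ zero → inv a ≠ zero
  mul_inv_cancel : ∀ a, a ≠ zero → mul a (inv a) = one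
  inv_mul_cancel : ∀ a, a ≠ zero → mul (inv a) a = one
  zero_mul : ∀ a, mul zero a = zero
  mul_zero : ∀ a, mul a zero = zero
  add_nonempty : ∀ a b, (add a b).Nonempty
  add_comm : ∀ a b, add a b = add b a
  add_assoc : ∀ a b c, (⋃ t ∈ add b c, add a t) = (⋃ s ∈ add a b, add s c)
  zero_add : ∀ a, add zero a = {a}
  add_neg_self : ∀ a, zero ∈ add a (neg a)
  neg_unique : ∀ a b, zero ∈ add a b → b = neg a
  reversibility : ∀ x y z, x ∈ add y z ↔ z ∈ add x (neg y)
  left_distrib : ∀ a x y, add (mul a x) (mul a y) = (fun t => mul a t) '' (add x y)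
  right_distrib : ∀ a x y, add (mul x a) (mul y a) = (fun t => mul t a) '' (add x y)

/-- The hyperaddition extended to subsets: `A ⊞ B = ⋃_{a ∈ A, b ∈ B} a ⊞ b`. -/
def SkewHyperfield.sadd {F : Type*} (H : SkewHyperfield F) (A B : Set F) : Set F :=
  ⋃ a ∈ A, ⋃ b ∈ B, H.add a b

/-- Strong Pathetic Cancellation. -/
def StrongPatheticCancellation {F : Type*} (H : SkewHyperfield F) : Prop :=
  ∀ a b x y : F, a ≠ H.zero → b ≠ H.zero → x ≠ H.zero → y ≠ H.zero →
    x ∈ H.add H.one a → y ∈ H.add (H.neg H.one) b →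
    H.add x y ∩ H.add a b ⊆ H.add (H.mul x b) (H.neg (H.mul a y))

/-- Pathetic Cancellation. -/
def PatheticCancellation {F : Type*} (H : SkewHyperfield F) : Prop :=
  ∀ a b x y z : F, a ≠ H.zero → b ≠ H.zero → x ≠ H.zero → y ≠ H.zero → z ≠ H.zero →
    x ∈ H.add H.one a → H.mul a x = H.mul x a →
    y ∈ H.add (H.neg H.one) b → H.mul b y = H.mul y b →
    z ∈ H.add a b →
    H.mul (H.mul (H.inv a) z) (H.inv b) = H.mul (H.mul (H.inv b) z) (H.inv a) →
    z ∈ H.add x y →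
    H.mul (H.mul (H.inv x) z) (H.inv y) = H.mul (H.mul (H.inv y) z) (H.inv x) →
    z ∈ H.add (H.mul x b) (H.neg (H.mul a y))



namespace SkewHyperfield

variable {F : Type*} (H : SkewHyperfield F)

theorem neg_neg (a : F) : H.neg (H.neg a) = a :=
  (H.neg_unique _ _ (H.add_comm a _ ▸ H.add_neg_self a)).symm

theorem mul_mem_add_left {x y z : F} (a : F) (h : z ∈ H.add x y) :
    H.mul a z ∈ H.add (H.mul a x) (H.mul a y) := by
  rw [H.left_distrib]
  exact ⟨z, h, rfl⟩

theorem mul_mem_add_right {x y z : F} (a : F) (h : z ∈ H.add x y) :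
    H.mul z a ∈ H.add (H.mul x a) (H.mul y a) := by
  rw [H.right_distrib]
  exact ⟨z, h, rfl⟩

theorem mul_neg (a b : F) : H.mul a (H.neg b) = H.neg (H.mul a b) := by
  apply H.neg_unique
  have h := H.mul_mem_add_left a (H.add_neg_self b)
  rwa [H.mul_zero] at h

theorem neg_mul (a b : F) : H.mul (H.neg a) b = H.neg (H.mul a b) := by
  apply H.neg_unique
  have h := H.mul_mem_add_right b (H.add_neg_self a)
  rwa [H.zero_mul] at h

theorem neg_mem_add {x y z : F} (h : z ∈ H.add x y) :
    H.neg z ∈ H.add (H.neg x) (H.neg y) := by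
  have h' := H.mul_mem_add_left (H.neg H.one) h
  simpa only [H.neg_mul, H.one_mul] using h'

theorem left_mem_add_neg {x y z : F} (h : z ∈ H.add x y) : x ∈ H.add z (H.neg y) := by
  rwa [H.add_comm, H.reversibility] at h

/-- If `p ⊞ q` and `r ⊞ s` meet, then so do `p ⊞ (-r)` and `s ⊞ (-q)`. -/
theorem transposition {p q r s z : F} (h : z ∈ H.add p q) (h' : z ∈ H.add r s) :
    (H.add p (H.neg r) ∩ H.add s (H.neg q)).Nonempty := by
  have hp : p ∈ ⋃ u ∈ H.add r s, H.add u (H.neg q) :=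
    Set.mem_biUnion h' (H.left_mem_add_neg h)
  rw [← H.add_assoc] at hp
  obtain ⟨t, ht, hpt⟩ := Set.mem_iUnion₂.mp hp
  exact ⟨t, (H.reversibility p r t).mp hpt, ht⟩

end SkewHyperfield

/-- for `x ∈ 1 ⊞ a` and `y ∈ (-1) ⊞ b`, the sets `x ⊞ y`, `a ⊞ b`
and `(x·b) ⊞ (-(a·y))` pairwise intersect. -/
theorem intersections_nonempty {F : Type*} (H : SkewHyperfield F) (a b x y : F)
    (hx : x ∈ H.add H.one a) (hy : y ∈ H.add (H.neg H.one) b) :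
    (H.add x y ∩ H.add a b).Nonempty ∧
    (H.add x y ∩ H.add (H.mul x b) (H.neg (H.mul a y))).Nonempty ∧
    (H.add a b ∩ H.add (H.mul x b) (H.neg (H.mul a y))).Nonempty := by
  refine ⟨?_, ?_, ?_⟩
  · have h₁ := H.left_mem_add_neg hx
    have h₂ := H.neg_mem_add (H.left_mem_add_neg hy)
    rw [H.neg_neg, H.neg_neg] at h₂
    have h := H.transposition h₁ h₂
    rwa [H.neg_neg, H.neg_neg, H.add_comm b a] at h
  · have h₁ := H.mul_mem_add_left x hy
    have h₂ := H.mul_mem_add_right y hx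
    rw [H.mul_neg, H.mul_one, H.add_comm] at h₁
    rw [H.one_mul, H.add_comm] at h₂
    have h := H.transposition h₁ h₂
    rwa [H.neg_neg, H.add_comm y x, Set.inter_comm] at h
  · have h₁ := (H.reversibility _ _ _).mp (H.mul_mem_add_right b hx)
    have h₂ := (H.reversibility _ _ _).mp (H.mul_mem_add_left a hy)
    rw [H.one_mul] at h₁
    rw [H.mul_neg, H.mul_one, H.neg_neg] at h₂
    have h := H.transposition h₁ h₂
    rwa [H.neg_neg, Set.inter_comm] at h

end PaperSHF
end

section
/- Let F be a skew hyperfield and let a, x ∈ F^× with 1 ⊞ a = {x}. Then a·x = x·a. -/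
open Set

namespace PaperSHF

/-- if `1 ⊞ a = {x}` with `a, x` nonzero, then `a·x = x·a`. -/
theorem comm_of_singleton_sum {F : Type*} (H : SkewHyperfield F) (a x : F)
    (ha : a ≠ H.zero) (hx : x ≠ H.zero) (hax : H.add H.one a = {x}) :
    H.mul a x = H.mul x a := by
  have hl := H.left_distrib a H.one a
  have hr := H.right_distrib a H.one a
  rw [hax, Set.image_singleton, H.mul_one] at hl
  rw [hax, Set.image_singleton, H.one_mul] at hr
  exact Set.singleton_injective (hl.symm.trans hr)

end PaperSHF
end
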